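/- (Differencing lemma) Let 0 < τ ≤ 1/64 and c₁, c₂ > 0. There exists a constant C₀'₀ (depending on τ) such that for every C₀' ≥ C₀'₀ the following holds for all sufficiently large n. Let t ∈ [−π,π] satisfy Condition(τ,C₀'), let D ∈ ℝ² with c₁ n^{5τ−1/2} ≤ ‖D‖₂ ≤ c₂ n^{1−8τ}, set ψ_j = ⟨D, v_j⟩ and ψ_j' = ⟨D, v_j'⟩, and suppose |{ j ∈ {1,…,n} : ‖ψ_j‖_{ℝ/ℤ} + ‖ψ_j'‖_{ℝ/ℤ} > n^{−τ} }| ≤ n^{3τ}. Then, with e = D/‖D‖₂, there exists a set J ⊆ {1,…,n} of at least n^{1−6τ} consecutive integers such that ∑_{j∈J} ( ⟨v_j, e⟩² + ⟨v_j', e⟩² ) ≥ n^{1−8τ} and |ψ_j| + |ψ_j'| ≤ n^{−τ} for every j ∈ J. -/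

import Mathlib

open MeasureTheory Real

/-- `t` satisfies Condition(τ, C₀'): there is no nonzero integer `k` with `|k| ≤ C₀'` such that
`‖kt/π‖_{ℝ/ℤ} ≤ n^{-1+8τ}`. -/
def Condition (n : ℕ) (τ C₀' t : ℝ) : Prop :=
  ∀ k : ℤ, k ≠ 0 → |(k : ℝ)| ≤ C₀' →
    ∀ m : ℤ, (n : ℝ) ^ (-1 + 8 * τ) < |(k : ℝ) * t / Real.pi - (m : ℝ)|

/-- The distance from `w` to the nearest integer, `‖w‖_{ℝ/ℤ}`. -/
noncomputable def distZ (w : ℝ) : ℝ := ⨅ m : ℤ, |w - (m : ℝ)|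

/-- `⟨v_i, x⟩` where `v_i = (cos(it), -(i/n) sin(it))`. -/
noncomputable def ipv (n : ℕ) (t : ℝ) (i : ℕ) (x : ℝ × ℝ) : ℝ :=
  Real.cos (i * t) * x.1 + (-((i : ℝ) / n) * Real.sin (i * t)) * x.2

/-- `⟨v_i', x⟩` where `v_i' = (sin(it), (i/n) cos(it))`. -/
noncomputable def ipv' (n : ℕ) (t : ℝ) (i : ℕ) (x : ℝ × ℝ) : ℝ :=
  Real.sin (i * t) * x.1 + ((i : ℝ) / n) * Real.cos (i * t) * x.2

/-- The complex numbers with integer real and imaginary parts. -/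
def IsGaussInt (c : ℂ) : Prop := ∃ a b : ℤ, c = a + b * Complex.I

lemma IsGaussInt.sub {c d : ℂ} (hc : IsGaussInt c) (hd : IsGaussInt d) : IsGaussInt (c - d) := by
  obtain ⟨a, b, rfl⟩ := hc
  obtain ⟨a', b', rfl⟩ := hd
  exact ⟨a - a', b - b', by push_cast; ring⟩

lemma IsGaussInt.eq_zero_of_norm_lt_one {c : ℂ} (hc : IsGaussInt c) (h : ‖c‖ < 1) : c = 0 := by
  obtain ⟨a, b, rfl⟩ := hc
  have ha := (Complex.abs_re_le_norm _).trans_lt h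
  have hb := (Complex.abs_im_le_norm _).trans_lt h
  simp only [Complex.add_re, Complex.intCast_re, Complex.mul_re, Complex.I_re, mul_zero,
    Complex.intCast_im, Complex.I_im, mul_one, sub_self, add_zero, Complex.add_im,
    Complex.mul_im, zero_add] at ha hb
  have ha' : a = 0 := Int.abs_lt_one_iff.mp (by exact_mod_cast ha)
  have hb' : b = 0 := Int.abs_lt_one_iff.mp (by exact_mod_cast hb)
  simp [ha', hb']

lemma isGaussInt_iterate_fwdDiff {w : ℕ → ℂ} (hw : ∀ j, IsGaussInt (w j)) (h s j : ℕ) :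
    IsGaussInt ((fwdDiff h)^[s] w j) := by
  induction s generalizing j with
  | zero => exact hw j
  | succ s ih =>
    rw [Function.iterate_succ_apply', fwdDiff]
    exact (ih _).sub (ih _)

/-- On a window where `z` and `w` are `ε`-close, their `s`-th differences are `2 ^ s * ε`-close. -/
lemma norm_iterate_fwdDiff_sub_le {z w : ℕ → ℂ} {a b h : ℕ} {ε : ℝ}
    (hzw : ∀ j, a ≤ j → j ≤ b → ‖z j - w j‖ ≤ ε) (s j : ℕ) (haj : a ≤ j) (hjb : j + s * h ≤ b) :
    ‖(fwdDiff h)^[s] z j - (fwdDiff h)^[s] w j‖ ≤ 2 ^ s * ε := by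
  induction s generalizing j with
  | zero => simpa using hzw j haj (by omega)
  | succ s ih =>
    simp only [Function.iterate_succ_apply', fwdDiff]
    rw [add_mul, one_mul] at hjb
    have h₁ := ih (j + h) (by omega) (by omega)
    have h₂ := ih j haj (by omega)
    calc _ = ‖((fwdDiff h)^[s] z (j + h) - (fwdDiff h)^[s] w (j + h))
          - ((fwdDiff h)^[s] z j - (fwdDiff h)^[s] w j)‖ := by congr 1; ring
      _ ≤ _ := norm_sub_le _ _
      _ ≤ 2 ^ s * ε + 2 ^ s * ε := add_le_add h₁ h₂
      _ = _ := by ring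

/-- Differences of a linear polynomial times the character `j ↦ exp (i j t)` have the same shape,
and their coefficients decay geometrically when `exp (i h t)` is close to `1`. -/
lemma exists_iterate_fwdDiff_exp_mul_linear (t : ℝ) (α β : ℂ) (h : ℕ) {δ : ℝ} (hδ : 0 < δ)
    (hω : ‖Complex.exp (h * t * Complex.I) - 1‖ ≤ δ) (s : ℕ) :
    ∃ α' β' : ℂ, (∀ j : ℕ, (fwdDiff h)^[s]
        (fun j : ℕ => Complex.exp (j * t * Complex.I) * (α + β * j)) j
          = Complex.exp (j * t * Complex.I) * (α' + β' * j)) ∧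
      ‖β'‖ ≤ (2 * δ) ^ s * ‖β‖ ∧ ‖α'‖ ≤ (2 * δ) ^ s * (‖α‖ + h * ‖β‖ / δ) := by
  induction s with
  | zero =>
    refine ⟨α, β, fun j => rfl, by simp, ?_⟩
    have : 0 ≤ h * ‖β‖ / δ := by positivity
    simpa using this
  | succ s ih =>
    obtain ⟨α', β', hf, hβ, hα⟩ := ih
    set ω := Complex.exp (h * t * Complex.I) with hωdef
    have hω1 : ‖ω‖ = 1 := by
      rw [hωdef]; exact_mod_cast Complex.norm_exp_ofReal_mul_I (h * t)
    refine ⟨(ω - 1) * α' + ω * h * β', (ω - 1) * β', fun j => ?_, ?_, ?_⟩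
    · rw [Function.iterate_succ_apply', fwdDiff, hf, hf]
      have : Complex.exp (((j + h : ℕ) : ℂ) * t * Complex.I)
          = Complex.exp (j * t * Complex.I) * ω := by
        rw [hωdef, ← Complex.exp_add]; push_cast; ring_nf
      rw [this]; push_cast; ring
    · rw [norm_mul]
      calc _ ≤ δ * ((2 * δ) ^ s * ‖β‖) := by gcongr
        _ ≤ 2 * (δ * ((2 * δ) ^ s * ‖β‖)) := by
          have : 0 ≤ δ * ((2 * δ) ^ s * ‖β‖) := by positivity
          linarith
        _ = _ := by ring
    · calc _ ≤ ‖ω - 1‖ * ‖α'‖ + h * ‖β'‖ := by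
            refine (norm_add_le _ _).trans (le_of_eq ?_)
            simp [hω1]
        _ ≤ δ * ((2 * δ) ^ s * (‖α‖ + h * ‖β‖ / δ)) + h * ((2 * δ) ^ s * ‖β‖) := by gcongr
        _ = (2 * δ) ^ s * (δ * ‖α‖ + 2 * (h * ‖β‖)) := by field_simp; ring
        _ ≤ (2 * δ) ^ s * (2 * (δ * ‖α‖) + 2 * (h * ‖β‖)) := by
            have : 0 ≤ δ * ‖α‖ := by positivity
            gcongr ?_ * ?_
            linarith
        _ = _ := by field_simp; ring

/-- If the `(s+1)`-st difference of `w` vanishes on a window, the `s`-th one is constant along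
progressions of step `h`. -/
lemma iterate_fwdDiff_add_mul_eq {w : ℕ → ℂ} {a b h s : ℕ}
    (hw : ∀ j, a ≤ j → j + (s + 1) * h ≤ b → (fwdDiff h)^[s + 1] w j = 0) (m j : ℕ)
    (haj : a ≤ j) (hjb : j + m * h + s * h ≤ b) :
    (fwdDiff h)^[s] w (j + m * h) = (fwdDiff h)^[s] w j := by
  induction m with
  | zero => simp
  | succ m ih =>
    rw [add_mul, one_mul] at hjb
    rw [← ih (by omega)]
    have := hw (j + m * h) (by omega) (by rw [add_mul]; omega)
    rw [Function.iterate_succ_apply', fwdDiff, sub_eq_zero] at this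
    rw [← this, add_mul, one_mul, add_assoc]

/-- A sequence `exp (i j t) (α + β j)` which, at three terms of a progression whose step rotates
by at least a quarter turn, is `η`-close to a constant Gaussian integer `c` forces `c = 0`. -/
lemma gaussInt_eq_zero_of_near {t : ℝ} {α β c : ℂ} {η : ℝ} {i g : ℕ} (hc : IsGaussInt c)
    (hη : 2 * η < 1) (hg : 2 ≤ ‖(1 - Complex.exp (g * t * Complex.I)) ^ 2‖)
    (h₀ : ‖Complex.exp (i * t * Complex.I) * (α + β * i) - c‖ ≤ η)
    (h₁ : ‖Complex.exp ((i + g : ℕ) * t * Complex.I) * (α + β * (i + g : ℕ)) - c‖ ≤ η)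
    (h₂ : ‖Complex.exp ((i + 2 * g : ℕ) * t * Complex.I) * (α + β * (i + 2 * g : ℕ)) - c‖ ≤ η) :
    c = 0 := by
  set ρ := Complex.exp (g * t * Complex.I) with hρ
  have hρ1 : ‖ρ‖ = 1 := by rw [hρ]; exact_mod_cast Complex.norm_exp_ofReal_mul_I (g * t)
  have e₁ : Complex.exp ((i + g : ℕ) * t * Complex.I) = Complex.exp (i * t * Complex.I) * ρ := by
    rw [hρ, ← Complex.exp_add]; push_cast; ring_nf
  have e₂ : Complex.exp ((i + 2 * g : ℕ) * t * Complex.I)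
      = Complex.exp (i * t * Complex.I) * ρ ^ 2 := by
    rw [hρ, ← Complex.exp_nat_mul, ← Complex.exp_add]; push_cast; ring_nf
  rw [e₁] at h₁
  rw [e₂] at h₂
  apply hc.eq_zero_of_norm_lt_one
  set E := Complex.exp (i * t * Complex.I)
  set d₀ := E * (α + β * i) - c with hd₀
  set d₁ := E * ρ * (α + β * (i + g : ℕ)) - c with hd₁
  set d₂ := E * ρ ^ 2 * (α + β * (i + 2 * g : ℕ)) - c with hd₂
  have key : c * (1 - ρ) ^ 2 = 2 * ρ * d₁ - ρ ^ 2 * d₀ - d₂ := by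
    rw [hd₀, hd₁, hd₂]; push_cast; ring
  have hle : ‖c * (1 - ρ) ^ 2‖ ≤ 4 * η := by
    rw [key]
    have n₁ : ‖2 * ρ * d₁‖ = 2 * ‖d₁‖ := by simp [hρ1]
    have n₀ : ‖ρ ^ 2 * d₀‖ = ‖d₀‖ := by simp [hρ1]
    have := norm_sub_le (2 * ρ * d₁ - ρ ^ 2 * d₀) d₂
    have := norm_sub_le (2 * ρ * d₁) (ρ ^ 2 * d₀)
    linarith
  rw [norm_mul] at hle
  nlinarith [norm_nonneg c]

/-- Differencing with a fixed step `h`: a Gaussian-integer sequence `w` that is close to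
`exp (i j t) (α + β j)` on a long window vanishes there. -/
lemma gaussInt_seq_eq_zero_of_near {t : ℝ} {α β : ℂ} {w : ℕ → ℂ} {a b h k r : ℕ} {δ ε : ℝ}
    (hw : ∀ j, IsGaussInt (w j))
    (hzw : ∀ j : ℕ, a ≤ j → j ≤ b →
      ‖Complex.exp (j * t * Complex.I) * (α + β * j) - w j‖ ≤ ε)
    (hε : 0 ≤ ε) (hr : 2 * (2 ^ r * ε) < 1) (hδ : 0 < δ)
    (hω : ‖Complex.exp (h * t * Complex.I) - 1‖ ≤ δ)
    (hsmall : (2 * δ) ^ r * (‖α‖ + h * ‖β‖ / δ + ‖β‖ * b) ≤ 1 / 2)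
    (hk : 2 ≤ ‖(1 - Complex.exp ((k * h : ℕ) * t * Complex.I)) ^ 2‖)
    (hlen : a + 4 * (k * h) + r * h ≤ b) (j : ℕ) (haj : a ≤ j) (hjb : j ≤ b) : w j = 0 := by
  have hbound (s : ℕ) (hs : s ≤ r) : 2 * (2 ^ s * ε) < 1 := by
    refine lt_of_le_of_lt ?_ hr
    have : (2 : ℝ) ^ s ≤ 2 ^ r := pow_le_pow_right₀ (by norm_num) hs
    gcongr
  suffices H : ∀ s ≤ r, ∀ j, a ≤ j → j + s * h ≤ b → (fwdDiff h)^[s] w j = 0 from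
    H 0 (Nat.zero_le _) j haj (by simpa using hjb)
  intro s hs
  induction hs using Nat.decreasingInduction with
  | self =>
    intro j haj hjb
    apply (isGaussInt_iterate_fwdDiff hw h r j).eq_zero_of_norm_lt_one
    have h₁ := norm_iterate_fwdDiff_sub_le (h := h) hzw r j haj hjb
    obtain ⟨α', β', hf, hβ, hα⟩ := exists_iterate_fwdDiff_exp_mul_linear t α β h hδ hω r
    have h₂ : ‖(fwdDiff h)^[r]
        (fun j : ℕ => Complex.exp (j * t * Complex.I) * (α + β * j)) j‖ ≤ 1 / 2 := by
      rw [hf, norm_mul]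
      have : ‖Complex.exp (j * t * Complex.I)‖ = 1 := by
        exact_mod_cast Complex.norm_exp_ofReal_mul_I (j * t)
      rw [this, one_mul]
      have hj : (j : ℝ) ≤ b := by exact_mod_cast (by omega : j ≤ b)
      calc _ ≤ ‖α'‖ + ‖β'‖ * j := by
            refine (norm_add_le _ _).trans (le_of_eq ?_); simp
        _ ≤ (2 * δ) ^ r * (‖α‖ + h * ‖β‖ / δ) + (2 * δ) ^ r * ‖β‖ * b := by gcongr
        _ ≤ 1 / 2 := by linarith
    have h₃ := norm_sub_le ((fwdDiff h)^[r]
        (fun j : ℕ => Complex.exp (j * t * Complex.I) * (α + β * j)) j)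
        ((fwdDiff h)^[r] (fun j : ℕ => Complex.exp (j * t * Complex.I) * (α + β * j)) j
          - (fwdDiff h)^[r] w j)
    rw [sub_sub_cancel] at h₃
    linarith
  | of_succ s hs ih =>
    intro j haj hjb
    obtain ⟨α', β', hf, -, -⟩ := exists_iterate_fwdDiff_exp_mul_linear t α β h hδ hω s
    have hsr : s * h ≤ r * h := Nat.mul_le_mul_right _ hs.le
    have e2 : 2 * k * h = 2 * (k * h) := by ring
    have close (l : ℕ) (hl : a ≤ l) (hl' : l + s * h ≤ b) :
        ‖Complex.exp (l * t * Complex.I) * (α' + β' * l) - (fwdDiff h)^[s] w l‖ ≤ 2 ^ s * ε := by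
      rw [← hf]; exact norm_iterate_fwdDiff_sub_le hzw s l hl hl'
    have main (i : ℕ) (hi : a ≤ i) (hi' : i + 2 * (k * h) + s * h ≤ b) :
        (fwdDiff h)^[s] w i = 0 := by
      have c₁ := close (i + k * h) (by omega) (by omega)
      have c₂ := close (i + 2 * (k * h)) (by omega) (by omega)
      rw [iterate_fwdDiff_add_mul_eq ih k i hi (by omega)] at c₁
      rw [← e2, iterate_fwdDiff_add_mul_eq ih (2 * k) i hi (by omega), e2] at c₂
      exact gaussInt_eq_zero_of_near (isGaussInt_iterate_fwdDiff hw h s i) (hbound s hs.le) hk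
        (close i hi (by omega)) c₁ c₂
    by_cases hcase : j + 2 * (k * h) + s * h ≤ b
    · exact main j haj hcase
    · obtain ⟨i, rfl⟩ : ∃ i, j = i + 2 * (k * h) := ⟨j - 2 * (k * h), by omega⟩
      rw [← e2, iterate_fwdDiff_add_mul_eq ih (2 * k) i (by omega) (by omega)]
      exact main i (by omega) (by omega)

/-- Some multiple of a small nonzero angle rotates by at least a quarter turn. -/
lemma exists_mul_angle_far {θ : ℝ} (h0 : θ ≠ 0) (hπ : |θ| ≤ Real.pi) :
    ∃ k : ℕ, (k : ℝ) ≤ Real.pi / (2 * |θ|) + 1 ∧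
      2 ≤ ‖(1 - Complex.exp (k * θ * Complex.I)) ^ 2‖ := by
  have hpos : 0 < |θ| := abs_pos.mpr h0
  have hp := Real.pi_pos
  refine ⟨⌈Real.pi / (2 * |θ|)⌉₊, (Nat.ceil_lt_add_one (by positivity)).le, ?_⟩
  set k := ⌈Real.pi / (2 * |θ|)⌉₊
  have hk₁ : Real.pi / 2 ≤ k * |θ| := by
    have := Nat.le_ceil (Real.pi / (2 * |θ|))
    calc Real.pi / 2 = Real.pi / (2 * |θ|) * |θ| := by field_simp
      _ ≤ _ := by gcongr
  have hk₂ : k * |θ| ≤ Real.pi + Real.pi / 2 := by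
    have := (Nat.ceil_lt_add_one (a := Real.pi / (2 * |θ|)) (by positivity)).le
    calc k * |θ| ≤ (Real.pi / (2 * |θ|) + 1) * |θ| := by gcongr
      _ = Real.pi / 2 + |θ| := by field_simp
      _ ≤ _ := by linarith
  have hcos : Real.cos (k * θ) ≤ 0 := by
    have := Real.cos_nonpos_of_pi_div_two_le_of_le hk₁ hk₂
    rwa [← Real.cos_abs, abs_mul, Nat.abs_cast]
  rw [norm_pow, ← Complex.normSq_eq_norm_sq]
  have : Complex.exp (k * θ * Complex.I)
      = ⟨Real.cos (k * θ), Real.sin (k * θ)⟩ := by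
    have h1 : (k * θ * Complex.I : ℂ) = ((k * θ : ℝ) : ℂ) * Complex.I := by push_cast; ring
    rw [h1]
    apply Complex.ext
    · exact Complex.exp_ofReal_mul_I_re _
    · exact Complex.exp_ofReal_mul_I_im _
  rw [this, Complex.normSq_apply]
  simp only [Complex.sub_re, Complex.one_re, Complex.sub_im, Complex.one_im]
  nlinarith [Real.sin_sq_add_cos_sq (k * θ)]

/-- Among `#B + 1` consecutive blocks of length `l`, one avoids `B`. -/
lemma exists_block_avoiding (B : Finset ℕ) (a l : ℕ) :
    ∃ i ≤ B.card, ∀ j, a + i * l ≤ j → j < a + (i + 1) * l → j ∉ B := by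
  by_contra! hcon
  choose! f hf₁ hf₂ hf₃ using hcon
  have hcard : B.card < (Finset.range (B.card + 1)).card := by simp
  obtain ⟨x, hx, y, hy, hxy, hfxy⟩ := Finset.exists_ne_map_eq_of_card_lt_of_maps_to hcard
    (f := f) (fun i hi => hf₃ i (by simpa [Nat.lt_succ_iff] using hi))
  have hlt (u v : ℕ) (hu : u ∈ Finset.range (B.card + 1)) (hv : v ∈ Finset.range (B.card + 1))
      (huv : u < v) : f u < f v := by
    have := Nat.mul_le_mul_right l (Nat.succ_le_of_lt huv)
    have h₁ := hf₂ u (by simpa [Nat.lt_succ_iff] using hu)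
    have h₂ := hf₁ v (by simpa [Nat.lt_succ_iff] using hv)
    simp only [Nat.succ_eq_add_one] at this
    omega
  rcases hxy.lt_or_gt with hh | hh
  · exact (hlt x y hx hy hh).ne hfxy
  · exact (hlt y x hy hx hh).ne hfxy.symm

lemma abs_sub_round_le_distZ (x : ℝ) : |x - round x| ≤ distZ x :=
  le_ciInf fun m => round_le x m

lemma exp_mul_linear_re (n : ℕ) (t : ℝ) (j : ℕ) (D : ℝ × ℝ) :
    (Complex.exp (j * t * Complex.I) * (D.1 + (D.2 / n : ℝ) * Complex.I * j)).re
      = ipv n t j D := by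
  have h1 : (j * t * Complex.I : ℂ) = ((j * t : ℝ) : ℂ) * Complex.I := by push_cast; ring
  rw [h1, Complex.mul_re, Complex.exp_ofReal_mul_I_re, Complex.exp_ofReal_mul_I_im, ipv]
  simp
  ring

lemma exp_mul_linear_im (n : ℕ) (t : ℝ) (j : ℕ) (D : ℝ × ℝ) :
    (Complex.exp (j * t * Complex.I) * (D.1 + (D.2 / n : ℝ) * Complex.I * j)).im
      = ipv' n t j D := by
  have h1 : (j * t * Complex.I : ℂ) = ((j * t : ℝ) : ℂ) * Complex.I := by push_cast; ring
  rw [h1, Complex.mul_im, Complex.exp_ofReal_mul_I_re, Complex.exp_ofReal_mul_I_im, ipv']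
  simp
  ring

lemma ipv_sq_add_ipv'_sq (n : ℕ) (t : ℝ) (j : ℕ) (D : ℝ × ℝ) :
    ipv n t j D ^ 2 + ipv' n t j D ^ 2 = D.1 ^ 2 + ((j : ℝ) / n) ^ 2 * D.2 ^ 2 := by
  have := Real.sin_sq_add_cos_sq (j * t)
  rw [ipv, ipv']
  linear_combination (D.1 ^ 2 + ((j : ℝ) / n) ^ 2 * D.2 ^ 2) * this

lemma abs_ipv_add_abs_ipv'_le_of_distZ_le {n : ℕ} {t : ℝ} {D : ℝ × ℝ} {a b h k r : ℕ} {δ ε : ℝ}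
    (hdist : ∀ j, a ≤ j → j ≤ b → distZ (ipv n t j D) + distZ (ipv' n t j D) ≤ ε)
    (hε : 0 ≤ ε) (hr : 2 * (2 ^ r * ε) < 1) (hδ : 0 < δ)
    (hω : ‖Complex.exp (h * t * Complex.I) - 1‖ ≤ δ)
    (hsmall : (2 * δ) ^ r * (|D.1| + h * (|D.2| / n) / δ + |D.2| / n * b) ≤ 1 / 2)
    (hk : 2 ≤ ‖(1 - Complex.exp ((k * h : ℕ) * t * Complex.I)) ^ 2‖)
    (hlen : a + 4 * (k * h) + r * h ≤ b) (j : ℕ) (haj : a ≤ j) (hjb : j ≤ b) :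
    |ipv n t j D| + |ipv' n t j D| ≤ ε := by
  set w : ℕ → ℂ := fun j => round (ipv n t j D) + round (ipv' n t j D) * Complex.I with hw
  have hround (j : ℕ) (haj : a ≤ j) (hjb : j ≤ b) :
      |ipv n t j D - round (ipv n t j D)| + |ipv' n t j D - round (ipv' n t j D)| ≤ ε :=
    (add_le_add (abs_sub_round_le_distZ _) (abs_sub_round_le_distZ _)).trans (hdist j haj hjb)
  have hz : w j = 0 := by
    refine gaussInt_seq_eq_zero_of_near (w := w) (t := t) (α := D.1) (β := (D.2 / n : ℝ) * Complex.I)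
      (fun j => ⟨_, _, rfl⟩) (fun j haj hjb => ?_) hε hr hδ hω ?_ hk hlen j haj hjb
    · refine (Complex.norm_le_abs_re_add_abs_im _).trans ?_
      rw [Complex.sub_re, Complex.sub_im, exp_mul_linear_re, exp_mul_linear_im]
      simpa [hw] using hround j haj hjb
    · simpa [abs_div] using hsmall
  have h₁ : (round (ipv n t j D) : ℝ) = 0 := by simpa [hw] using congrArg Complex.re hz
  have h₂ : (round (ipv' n t j D) : ℝ) = 0 := by simpa [hw] using congrArg Complex.im hz
  simpa [h₁, h₂] using hround j haj hjb

/-- Dirichlet approximation gives a bounded step `h` for which `exp (i h t)` is within `1 / (2M)`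
of `1`; the Condition keeps it away from `1`, so a moderate multiple of `h` rotates far. -/
lemma exists_step_of_condition {n : ℕ} {τ C t : ℝ} {M : ℕ} (hM : 0 < M)
    (hC : ((16 * M : ℕ) : ℝ) ≤ C) (hn : 0 < n) (ht : Condition n τ C t) :
    ∃ h k : ℕ, h ≤ 16 * M ∧ (k : ℝ) ≤ (n : ℝ) ^ (1 - 8 * τ) / 2 + 1 ∧
      ‖Complex.exp (h * t * Complex.I) - 1‖ ≤ 1 / (2 * M) ∧
      2 ≤ ‖(1 - Complex.exp ((k * h : ℕ) * t * Complex.I)) ^ 2‖ := by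
  have hπ := Real.pi_pos
  have hn' : (0 : ℝ) < n := by exact_mod_cast hn
  have hM1 : (1 : ℝ) ≤ M := by exact_mod_cast hM
  obtain ⟨h, h0, hH, happ⟩ := Real.exists_nat_abs_mul_sub_round_le (t / (2 * Real.pi))
    (n := 16 * M) (by positivity)
  set m := round (h * (t / (2 * Real.pi)))
  set θ := h * t - 2 * Real.pi * m with hθ
  have hθ' : θ = 2 * Real.pi * (h * (t / (2 * Real.pi)) - m) := by rw [hθ]; field_simp
  have hθle : |θ| ≤ 2 * Real.pi * (1 / ((16 * M : ℕ) + 1)) := by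
    rw [hθ', abs_mul, abs_of_pos (by positivity : 0 < 2 * Real.pi)]
    gcongr
  have hθδ : |θ| ≤ 1 / (2 * M) := by
    refine hθle.trans ?_
    rw [mul_one_div, div_le_div_iff₀ (by positivity) (by positivity)]
    push_cast
    nlinarith [Real.pi_lt_four]
  have hfar : Real.pi * (n : ℝ) ^ (-1 + 8 * τ) < |θ| := by
    have h1 := ht h (by exact_mod_cast h0.ne')
      (by rw [Int.cast_natCast, Nat.abs_cast]; exact (by exact_mod_cast hH : (h : ℝ) ≤ _).trans hC)
      (2 * m)
    have h2 : θ = Real.pi * (((h : ℤ) : ℝ) * t / Real.pi - ((2 * m : ℤ) : ℝ)) := by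
      rw [hθ]; push_cast; field_simp
    rw [h2, abs_mul, abs_of_pos hπ]
    gcongr
  have hθpos : 0 < |θ| := lt_of_le_of_lt (by positivity) hfar
  have hexp : Complex.exp (h * t * Complex.I) = Complex.exp (θ * Complex.I) := by
    rw [Complex.exp_eq_exp_iff_exists_int]
    exact ⟨m, by rw [hθ]; push_cast; ring⟩
  obtain ⟨k, hk, hk2⟩ := exists_mul_angle_far (abs_pos.mp hθpos) (by
    refine hθδ.trans (le_trans ?_ Real.pi_gt_three.le)
    rw [div_le_iff₀ (by positivity)]; linarith)
  refine ⟨h, k, hH, hk.trans ?_, ?_, ?_⟩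
  · refine add_le_add_left ?_ 1
    rw [div_le_div_iff₀ (by positivity) two_pos]
    have : (n : ℝ) ^ (1 - 8 * τ) * (n : ℝ) ^ (-1 + 8 * τ) = 1 := by
      rw [← Real.rpow_add hn']; simp
    have hp : 0 < (n : ℝ) ^ (1 - 8 * τ) := by positivity
    calc Real.pi * 2 = (n : ℝ) ^ (1 - 8 * τ) * (Real.pi * (n : ℝ) ^ (-1 + 8 * τ)) * 2 := by
          rw [mul_left_comm, this, mul_one]
      _ ≤ (n : ℝ) ^ (1 - 8 * τ) * |θ| * 2 := by gcongr
      _ = _ := by ring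
  · rw [hexp]
    refine le_trans ?_ hθδ
    rw [mul_comm]
    simpa using Real.norm_exp_I_mul_ofReal_sub_one_le (x := θ)
  · convert hk2 using 4
    calc Complex.exp ((k * h : ℕ) * t * Complex.I) = Complex.exp (h * t * Complex.I) ^ k := by
          rw [← Complex.exp_nat_mul]; push_cast; ring_nf
      _ = _ := by rw [hexp, ← Complex.exp_nat_mul]; ring_nf

/-- A set `B` of at most `u ^ 6` integers misses a block of `⌈n / u ^ 8⌉` consecutive integers in
the upper half of `{1, …, n}`. -/
lemma exists_window_avoiding {n : ℕ} {u : ℝ} (hu : 4 ≤ u) (hn : u ^ 16 ≤ n) {B : Finset ℕ}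
    (hB : (B.card : ℝ) ≤ u ^ 6) :
    ∃ a L : ℕ, n < 2 * a ∧ a + L ≤ n ∧ L + 1 = ⌈(n : ℝ) / u ^ 8⌉₊ ∧
      ∀ j, a ≤ j → j ≤ a + L → j ∉ B := by
  have hu0 : 0 < u := by linarith
  have hu1 : 1 ≤ u := by linarith
  have hn0 : (0 : ℝ) < n := lt_of_lt_of_le (by positivity) hn
  set l := ⌈(n : ℝ) / u ^ 8⌉₊ with hl
  have hl0 : 0 < l := Nat.ceil_pos.mpr (by positivity)
  have hone : 1 ≤ (n : ℝ) / u ^ 8 := by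
    rw [one_le_div (by positivity)]
    exact (pow_le_pow_right₀ hu1 (by norm_num)).trans hn
  have hlle : (l : ℝ) ≤ 2 * (n / u ^ 8) := by
    have := (Nat.ceil_lt_add_one (a := (n : ℝ) / u ^ 8) (by positivity)).le
    linarith
  obtain ⟨i, hi, hav⟩ := exists_block_avoiding B (n / 2 + 1) l
  have hsize : (B.card + 1) * l ≤ n / 2 := by
    rw [Nat.le_div_iff_mul_le two_pos]
    have h6 : (1 : ℝ) ≤ u ^ 6 := one_le_pow₀ hu1
    have : ((B.card : ℝ) + 1) * l * 2 ≤ n := by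
      calc ((B.card : ℝ) + 1) * l * 2 ≤ (u ^ 6 + u ^ 6) * (2 * (n / u ^ 8)) * 2 := by gcongr
        _ = 8 / u ^ 2 * n := by field_simp; ring
        _ ≤ 1 * n := by
          gcongr
          rw [div_le_one (by positivity)]
          nlinarith
        _ = n := one_mul _
    exact_mod_cast this
  have hil : (i + 1) * l ≤ (B.card + 1) * l := Nat.mul_le_mul_right _ (by omega)
  rw [add_mul i, one_mul] at hil
  refine ⟨n / 2 + 1 + i * l, l - 1, by omega, by omega, by omega, fun j h₁ h₂ => hav j h₁ ?_⟩
  rw [add_mul, one_mul]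
  omega

lemma sum_ipv_sq_ge {n a L : ℕ} (ha : n < 2 * a) (hn : 0 < n) (t : ℝ) {D : ℝ × ℝ}
    (hD : D.1 ^ 2 + D.2 ^ 2 = 1) :
    ((L : ℝ) + 1) / 4 ≤ ∑ j ∈ Finset.Icc a (a + L), (ipv n t j D ^ 2 + ipv' n t j D ^ 2) := by
  have hn' : (0 : ℝ) < n := by exact_mod_cast hn
  have h : ∀ j ∈ Finset.Icc a (a + L), (1 / 4 : ℝ) ≤ ipv n t j D ^ 2 + ipv' n t j D ^ 2 := by
    intro j hj
    rw [ipv_sq_add_ipv'_sq]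
    have hja : (n : ℝ) ≤ 2 * j := by
      have := (Finset.mem_Icc.mp hj).1
      exact_mod_cast (by omega : n ≤ 2 * j)
    have h1 : 1 / 2 ≤ (j : ℝ) / n := by rw [le_div_iff₀ hn']; linarith
    have h2 : 1 / 4 ≤ ((j : ℝ) / n) ^ 2 := by nlinarith
    nlinarith [sq_nonneg D.1, sq_nonneg D.2]
  have := Finset.card_nsmul_le_sum _ _ _ h
  rw [Nat.card_Icc, nsmul_eq_mul] at this
  have h2 : ((a + L + 1 - a : ℕ) : ℝ) = L + 1 := by
    rw [show a + L + 1 - a = L + 1 by omega]; push_cast; ring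
  rw [h2] at this
  linarith

/-- The size estimate for the `r`-th difference, where `2 ^ r` is comparable to `u`. -/
lemma pow_mul_size_le {n b h p r : ℕ} {u c s x y : ℝ} (hx : |x| ≤ s) (hy : |y| ≤ s)
    (hs : s ≤ c * (n / u ^ 16)) (hc : 0 < c) (hu : 1 ≤ u) (hup : n ≤ u ^ p) (hn : 0 < n)
    (hr : u < 2 ^ (r + 1)) (hb : b ≤ n) (hh : h ≤ 16 * 2 ^ p) (hnp : 32 * (2 ^ p) ^ 2 ≤ (n : ℝ))
    (huc : 6 * c * 2 ^ p ≤ u) :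
    (2 * (1 / (2 * ((2 ^ p : ℕ) : ℝ)))) ^ r
      * (|x| + h * (|y| / n) / (1 / (2 * ((2 ^ p : ℕ) : ℝ))) + |y| / n * b) ≤ 1 / 2 := by
  have hn' : (0 : ℝ) < n := by exact_mod_cast hn
  have hs0 : 0 ≤ s := (abs_nonneg x).trans hx
  have hb' : (b : ℝ) ≤ n := by exact_mod_cast hb
  have hh' : (h : ℝ) ≤ 16 * 2 ^ p := by exact_mod_cast hh
  have hu0 : 0 < u := by linarith
  have t₁ : (2 * (1 / (2 * ((2 ^ p : ℕ) : ℝ)))) ^ r ≤ 2 ^ p / n := by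
    have e : (2 * (1 / (2 * ((2 ^ p : ℕ) : ℝ)))) ^ r = 1 / ((2 : ℝ) ^ r) ^ p := by
      push_cast
      rw [← pow_mul, mul_comm r p, pow_mul, ← one_div_pow]
      congr 1
      field_simp
    rw [e, div_le_div_iff₀ (by positivity) hn', one_mul, ← mul_pow]
    refine hup.trans (pow_le_pow_left₀ hu0.le ?_ _)
    rw [pow_succ] at hr
    linarith
  have t₂ : |y| / n * b ≤ s := by
    calc |y| / n * b ≤ s / n * n := by gcongr
      _ = s := by field_simp
  have t₃ : h * (|y| / n) / (1 / (2 * ((2 ^ p : ℕ) : ℝ))) ≤ s := by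
    calc h * (|y| / n) / (1 / (2 * ((2 ^ p : ℕ) : ℝ)))
        ≤ (16 * 2 ^ p) * (s / n) / (1 / (2 * ((2 ^ p : ℕ) : ℝ))) := by gcongr
      _ = 32 * (2 ^ p) ^ 2 * (s / n) := by push_cast; field_simp; ring
      _ ≤ n * (s / n) := by gcongr
      _ = s := by field_simp
  have hu16 : u ≤ u ^ 16 := le_self_pow₀ hu (by norm_num)
  calc _ ≤ 2 ^ p / n * (s + s + s) := by gcongr
    _ ≤ 2 ^ p / n * (3 * (c * (n / u ^ 16))) := by gcongr; linarith
    _ = 6 * c * 2 ^ p / u ^ 16 * (1 / 2) := by field_simp; ring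
    _ ≤ 1 * (1 / 2) := by
      gcongr
      rw [div_le_one (by positivity)]
      linarith
    _ = 1 / 2 := one_mul _

/-- The window is long compared with the steps that are used. -/
lemma four_mul_add_le_of_window {n L h k r M : ℕ} {u : ℝ} (hu : 4 ≤ u) (hn : u ^ 32 ≤ n)
    (hL : L + 1 = ⌈(n : ℝ) / u ^ 8⌉₊) (hh : h ≤ M) (hk : (k : ℝ) ≤ n / u ^ 16 / 2 + 1)
    (hr : (2 : ℝ) ^ r ≤ u) (hM : 5 * (M : ℝ) + 1 ≤ u) :
    4 * (k * h) + r * h ≤ L := by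
  have hu0 : 0 < u := by linarith
  have hu1 : 1 ≤ u := by linarith
  set N := (n : ℝ) / u ^ 16 with hN
  have hn16 : u ^ 16 ≤ N := by
    rw [hN, le_div_iff₀ (by positivity), ← pow_add]
    exact hn
  have huN : u ≤ N := (le_self_pow₀ hu1 (by norm_num)).trans hn16
  have hk' : (k : ℝ) ≤ N := by linarith
  have hr' : (r : ℝ) ≤ N := by
    have : (r : ℝ) ≤ 2 ^ r := by exact_mod_cast Nat.lt_two_pow_self.le
    linarith
  have hh' : (h : ℝ) ≤ M := by exact_mod_cast hh
  have hN0 : 0 ≤ N := by linarith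
  have hlow : (n : ℝ) / u ^ 8 ≤ L + 1 := by
    have := Nat.le_ceil ((n : ℝ) / u ^ 8)
    rw [← hL] at this
    exact_mod_cast this
  have h8 : (n : ℝ) / u ^ 8 = u ^ 8 * N := by rw [hN]; field_simp
  have hu8 : u ≤ u ^ 8 := le_self_pow₀ hu1 (by norm_num)
  have hfin : 4 * ((k : ℝ) * h) + r * h ≤ L := by
    calc 4 * ((k : ℝ) * h) + r * h ≤ 4 * (N * M) + N * M := by gcongr
      _ = (5 * (M : ℝ) + 1) * N - N := by ring
      _ ≤ u ^ 8 * N - N := by gcongr; linarith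
      _ ≤ L := by linarith
  exact_mod_cast hfin

theorem stmt13 (τ c₁ c₂ : ℝ) (hτ : 0 < τ) (hτ' : τ ≤ 1 / 64)
    (hc₁ : 0 < c₁) (hc₂ : 0 < c₂) :
    ∃ C₀'₀ : ℝ, ∀ C₀' ≥ C₀'₀, ∃ n₀ : ℕ, ∀ n : ℕ, n₀ ≤ n →
      ∀ t ∈ Set.Icc (-Real.pi) Real.pi, Condition n τ C₀' t →
      ∀ D : ℝ × ℝ,
        c₁ * (n : ℝ) ^ (5 * τ - 1 / 2) ≤ Real.sqrt (D.1 ^ 2 + D.2 ^ 2) →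
        Real.sqrt (D.1 ^ 2 + D.2 ^ 2) ≤ c₂ * (n : ℝ) ^ (1 - 8 * τ) →
        ((Set.ncard {j : ℕ | j ∈ Finset.Icc 1 n ∧
            (n : ℝ) ^ (-τ) < distZ (ipv n t j D) + distZ (ipv' n t j D)} : ℝ)
          ≤ (n : ℝ) ^ (3 * τ)) →
        ∃ a L : ℕ, Finset.Icc a (a + L) ⊆ Finset.Icc 1 n ∧
          (n : ℝ) ^ (1 - 6 * τ) ≤ ((L : ℝ) + 1) ∧
          (n : ℝ) ^ (1 - 8 * τ) ≤ ∑ j ∈ Finset.Icc a (a + L),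
            ((ipv n t j (D.1 / Real.sqrt (D.1 ^ 2 + D.2 ^ 2),
                         D.2 / Real.sqrt (D.1 ^ 2 + D.2 ^ 2))) ^ 2 +
             (ipv' n t j (D.1 / Real.sqrt (D.1 ^ 2 + D.2 ^ 2),
                          D.2 / Real.sqrt (D.1 ^ 2 + D.2 ^ 2))) ^ 2) ∧
          ∀ j ∈ Finset.Icc a (a + L),
            |ipv n t j D| + |ipv' n t j D| ≤ (n : ℝ) ^ (-τ) := by
  set p := ⌈2 / τ⌉₊ with hp
  set H : ℕ := 16 * 2 ^ p with hH
  refine ⟨H, fun C hC => ?_⟩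
  obtain ⟨n₀, hn₀⟩ := Filter.eventually_atTop.mp
    (((tendsto_rpow_atTop (half_pos hτ)).comp tendsto_natCast_atTop_atTop).eventually_ge_atTop
      (4 + 6 * c₂ * 2 ^ p + 32 * (2 ^ p) ^ 2 + (5 * (H : ℝ) + 1)))
  refine ⟨max n₀ 1, fun n hn t _ ht D hD₁ hD₂ hbad => ?_⟩
  have hn1 : 0 < n := by omega
  have hnpos : (0 : ℝ) < n := by exact_mod_cast hn1
  have hnone : (1 : ℝ) ≤ n := by exact_mod_cast hn1
  have hu := hn₀ n (by omega)
  simp only [Function.comp_apply] at hu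
  set u := (n : ℝ) ^ (τ / 2) with hudef
  have q₁ : 0 ≤ 6 * c₂ * 2 ^ p := by positivity
  have q₂ : (0 : ℝ) ≤ 32 * (2 ^ p) ^ 2 := by positivity
  have q₃ : 0 ≤ 5 * (H : ℝ) := by positivity
  have hu4 : 4 ≤ u := by linarith
  have hu0 : 0 < u := by linarith
  have hu1 : 1 ≤ u := by linarith
  have hpow (m : ℕ) : u ^ m = (n : ℝ) ^ (τ / 2 * m) := by
    rw [hudef, Real.rpow_mul hnpos.le, Real.rpow_natCast]
  have hdiv (m : ℕ) : n / u ^ m = (n : ℝ) ^ (1 - τ / 2 * m) := by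
    rw [hpow, Real.rpow_sub hnpos, Real.rpow_one]
  have e₁ : (n : ℝ) ^ (-τ) = 1 / u ^ 2 := by
    rw [hpow, one_div, ← Real.rpow_neg hnpos.le]; congr 1; push_cast; ring
  have e₃ : (n : ℝ) ^ (3 * τ) = u ^ 6 := by rw [hpow]; congr 1; push_cast; ring
  have e₆ : (n : ℝ) ^ (1 - 6 * τ) = n / u ^ 12 := by rw [hdiv]; congr 1; push_cast; ring
  have e₈ : (n : ℝ) ^ (1 - 8 * τ) = n / u ^ 16 := by rw [hdiv]; congr 1; push_cast; ring
  have hn32 : u ^ 32 ≤ n := by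
    rw [hpow]
    calc (n : ℝ) ^ (τ / 2 * (32 : ℕ)) ≤ (n : ℝ) ^ (1 : ℝ) :=
          Real.rpow_le_rpow_of_exponent_le hnone (by push_cast; linarith)
      _ = n := Real.rpow_one _
  have hun : u ≤ n := (le_self_pow₀ hu1 (by norm_num)).trans hn32
  have hup : (n : ℝ) ≤ u ^ p := by
    rw [hpow]
    calc (n : ℝ) = (n : ℝ) ^ (1 : ℝ) := (Real.rpow_one _).symm
      _ ≤ _ := Real.rpow_le_rpow_of_exponent_le hnone (by
        have := Nat.le_ceil (2 / τ)
        rw [div_le_iff₀ hτ] at this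
        linarith)
  rw [e₁, e₃] at hbad
  rw [e₈] at hD₂
  rw [e₁, e₆, e₈]
  set s := Real.sqrt (D.1 ^ 2 + D.2 ^ 2) with hs
  have hspos : 0 < s := lt_of_lt_of_le (by positivity) hD₁
  have hs2 : s ^ 2 = D.1 ^ 2 + D.2 ^ 2 := Real.sq_sqrt (by positivity)
  classical
  set B := (Finset.Icc 1 n).filter
    (fun j => 1 / u ^ 2 < distZ (ipv n t j D) + distZ (ipv' n t j D)) with hB
  have hBcard : (B.card : ℝ) ≤ u ^ 6 := by
    rw [← Set.ncard_coe_finset, hB, Finset.coe_filter]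
    exact hbad
  obtain ⟨a, L, ha, haL, hL, hav⟩ := exists_window_avoiding hu4
    ((pow_le_pow_right₀ hu1 (by norm_num)).trans hn32) hBcard
  obtain ⟨h, k, hh, hk, hω, hrot⟩ := exists_step_of_condition (M := 2 ^ p) (by positivity)
    (by exact_mod_cast hC) hn1 ht
  rw [e₈] at hk
  obtain ⟨r, hr₁, hr₂⟩ := exists_nat_pow_near hu1 one_lt_two
  have hwin := four_mul_add_le_of_window hu4 hn32 hL hh hk hr₁ (by linarith)
  have hlow : (n : ℝ) / u ^ 8 ≤ L + 1 := by
    have := Nat.le_ceil ((n : ℝ) / u ^ 8)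
    rw [← hL] at this
    exact_mod_cast this
  refine ⟨a, L, ?_, ?_, ?_, ?_⟩
  · exact Finset.Icc_subset_Icc (by omega) haL
  · refine le_trans ?_ hlow
    gcongr
    norm_num
  · refine le_trans ?_ (sum_ipv_sq_ge ha hn1 t ?_)
    · calc (n : ℝ) / u ^ 16 = n / u ^ 8 / u ^ 8 := by field_simp
        _ ≤ ((L : ℝ) + 1) / 4 := by
          gcongr
          exact hu4.trans (le_self_pow₀ hu1 (by norm_num))
    · simp only [div_pow]
      rw [← add_div, ← hs2, div_self (by positivity)]
  · intro j hj
    rw [Finset.mem_Icc] at hj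
    refine abs_ipv_add_abs_ipv'_le_of_distZ_le (r := r) (fun i hi₁ hi₂ => ?_) (by positivity) ?_
      (by positivity) hω ?_ hrot (by omega) j hj.1 hj.2
    · have := hav i hi₁ hi₂
      simpa [hB, (by omega : 1 ≤ i), (by omega : i ≤ n)] using this
    · calc 2 * (2 ^ r * (1 / u ^ 2)) ≤ 2 * (u * (1 / u ^ 2)) := by gcongr
        _ = 2 / u := by field_simp
        _ < 1 := by rw [div_lt_one hu0]; linarith
    · refine pow_mul_size_le ?_ ?_ hD₂ hc₂ hu1 hup hn1 hr₂ haL hh (by linarith) (by linarith)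
      · exact Real.abs_le_sqrt (by nlinarith [sq_nonneg D.2])
      · exact Real.abs_le_sqrt (by nlinarith [sq_nonneg D.1])
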